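/- Determinism of the branch-free format decoder: define a recursive decoder for branch-free, length-determinate formats that consumes a fixed number of bits per subformat; then the decoder succeeds on p iff p ⊨ φ holds (soundness and completeness of the decoder with respect to the matching relation). -/

import Mathlib

inductive BFFormat (V : Type) where
  | eps : BFFormat V
  | encMatch : V → BFFormat V
  | plain : List Bool → BFFormat V
  | cat : BFFormat V → BFFormat V → BFFormat V

inductive BFMatches {V : Type} (enc : V → List Bool) : List Bool → BFFormat V → Prop where
  | eps : BFMatches enc [] .eps
  | encMatch (v : V) : BFMatches enc (enc v) (.encMatch v)
  | plain (p : List Bool) : BFMatches enc p (.plain p)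
  | cat {p₁ p₂ f₁ f₂} : BFMatches enc p₁ f₁ → BFMatches enc p₂ f₂ →
      BFMatches enc (p₁ ++ p₂) (.cat f₁ f₂)

/-- length of any stream matching a format, given that all encodings have length `n` -/
def fmtLen {V : Type} (n : ℕ) : BFFormat V → ℕ
  | .eps => 0
  | .encMatch _ => n
  | .plain p => p.length
  | .cat f₁ f₂ => fmtLen n f₁ + fmtLen n f₂

def dec {V : Type} (enc : V → List Bool) (n : ℕ) : BFFormat V → List Bool → Bool
  | .eps, p => decide (p = [])
  | .encMatch v, p => decide (p = enc v)
  | .plain p', p => decide (p = p')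
  | .cat f₁ f₂, p => dec enc n f₁ (p.take (fmtLen n f₁)) && dec enc n f₂ (p.drop (fmtLen n f₁))

theorem BFMatches.length_eq {V : Type} {enc : V → List Bool} {n : ℕ}
    (hlen : ∀ v : V, (enc v).length = n) {p : List Bool} {φ : BFFormat V}
    (h : BFMatches enc p φ) : p.length = fmtLen n φ := by
  induction h with
  | eps => rfl
  | encMatch v => exact hlen v
  | plain p => rfl
  | cat _ _ ih₁ ih₂ => simp [fmtLen, ih₁, ih₂]

theorem dec_correct {V : Type} (enc : V → List Bool) (n : ℕ)
    (hlen : ∀ v : V, (enc v).length = n) (hinj : Function.Injective enc)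
    (φ : BFFormat V) (p : List Bool) :
    dec enc n φ p = true ↔ BFMatches enc p φ := by
  induction φ generalizing p with
  | eps =>
    simp only [dec, decide_eq_true_eq]
    constructor
    · rintro rfl
      exact .eps
    · intro h
      cases h
      rfl
  | encMatch v =>
    simp only [dec, decide_eq_true_eq]
    constructor
    · rintro rfl
      exact .encMatch v
    · intro h
      cases h
      rfl
  | plain q =>
    simp only [dec, decide_eq_true_eq]
    constructor
    · rintro rfl
      exact .plain _
    · intro h
      cases h
      rfl
  | cat f₁ f₂ ih₁ ih₂ =>
    simp only [dec, Bool.and_eq_true, ih₁, ih₂]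
    constructor
    · rintro ⟨h₁, h₂⟩
      have h := BFMatches.cat h₁ h₂
      rwa [List.take_append_drop] at h
    · intro h
      cases h with
      | cat h₁ h₂ =>
        rw [← h₁.length_eq hlen, List.take_left, List.drop_left]
        exact ⟨h₁, h₂⟩
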